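/- Let p be a prime, let k be a field of characteristic p, and let G be a locally profinite group that contains an open pro-p subgroup, contains no proper open centralisers, and whose center Z(G) is finite. Then the k-algebra of k-linear endomorphisms of C_c^∞(G,k) commuting with both the left translation action (g ·_ℓ f)(x) = f(g⁻¹x) and the right translation action (g ·_r f)(x) = f(xg) of G is isomorphic as a k-algebra to the group algebra k[Z(G)]. -/

import Mathlib

/-- The space `C_c^∞(G,k)` of locally constant compactly supported `k`-valued functions,
as a `k`-submodule of `G → k`. -/
def SmoothCc (k G : Type*) [Field k] [TopologicalSpace G] : Submodule k (G → k) where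
  carrier := {f | IsLocallyConstant f ∧ HasCompactSupport f}
  add_mem' := fun hf hg => ⟨hf.1.add hg.1, hf.2.add hg.2⟩
  zero_mem' := ⟨IsLocallyConstant.const 0, by
    rw [HasCompactSupport, tsupport]
    simp⟩
  smul_mem' := fun c f hf => ⟨hf.1.comp (c * ·), by
    have h := HasCompactSupport.smul_left (f := fun _ : G => c) hf.2
    exact h⟩

/-- A `k`-linear endomorphism `T` of `C_c^∞(G,k)` commutes with the left translation
action `(g ·ℓ f)(x) = f(g⁻¹x)` of `G`. -/
def CommutesLeft {k G : Type*} [Field k] [Group G] [TopologicalSpace G]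
    (T : Module.End k (SmoothCc k G)) : Prop :=
  ∀ (g : G) (f h : SmoothCc k G), (∀ x : G, (h : G → k) x = (f : G → k) (g⁻¹ * x)) →
    ∀ x : G, (T h : G → k) x = (T f : G → k) (g⁻¹ * x)

/-- A `k`-linear endomorphism `T` of `C_c^∞(G,k)` commutes with the right translation
action `(g ·r f)(x) = f(xg)` of `G`. -/
def CommutesRight {k G : Type*} [Field k] [Group G] [TopologicalSpace G]
    (T : Module.End k (SmoothCc k G)) : Prop :=
  ∀ (g : G) (f h : SmoothCc k G), (∀ x : G, (h : G → k) x = (f : G → k) (x * g)) →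
    ∀ x : G, (T h : G → k) x = (T f : G → k) (x * g)


namespace BC

open scoped Classical in
lemma exists_fixed {p : ℕ} (hp : p.Prime) {k Q H : Type*} [Field k] [CharP k p] [Group Q] [Fintype Q]
    [Group H] (hQ : IsPGroup p Q) (a b : H →* Q) (φ : Q → k)
    (hinv : ∀ u q, φ (a u * q * (b u)⁻¹) = φ q) (hs : ∑ q, φ q ≠ 0) :
    ∃ q, ∀ u, a u * q * (b u)⁻¹ = q := by
  haveI : Fact p.Prime := ⟨hp⟩
  have hQQ : IsPGroup p (Q × Q) := by
    obtain ⟨n, hn⟩ := IsPGroup.iff_card.1 hQ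
    apply IsPGroup.of_card (n := n + n)
    rw [Nat.card_prod, hn, pow_add]
  have hP : IsPGroup p (a.prod b).range := hQQ.to_subgroup _
  by_contra hno
  apply hs
  rw [Finset.sum_comp (fun c : k => c) φ]
  apply Finset.sum_eq_zero
  intro c _
  letI : MulAction (a.prod b).range {q : Q // φ q = c} :=
    { smul := fun g q => ⟨g.1.1 * q.1 * (g.1.2)⁻¹, by
        obtain ⟨⟨x, y⟩, u, hu⟩ := g
        simp only [MonoidHom.prod_apply, Prod.mk.injEq] at hu
        obtain ⟨rfl, rfl⟩ := hu
        exact (hinv u q.1).trans q.2⟩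
      one_smul := fun q => Subtype.ext (by
        change (1 : Q) * q.1 * (1 : Q)⁻¹ = q.1
        simp)
      mul_smul := fun g h q => Subtype.ext (by
        change (g.1.1 * h.1.1) * q.1 * (g.1.2 * h.1.2)⁻¹
          = g.1.1 * (h.1.1 * q.1 * (h.1.2)⁻¹) * (g.1.2)⁻¹
        simp [mul_assoc]) }
  have hd : p ∣ Nat.card {q : Q // φ q = c} := by
    by_contra hnd
    obtain ⟨q, hq⟩ := hP.nonempty_fixed_point_of_prime_not_dvd_card {q : Q // φ q = c} hnd
    exact hno ⟨q.1, fun u => congrArg Subtype.val (hq ⟨(a u, b u), u, rfl⟩)⟩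
  have : (Finset.univ.filter fun q => φ q = c).card = Nat.card {q : Q // φ q = c} := by
    rw [Nat.card_eq_fintype_card, Fintype.card_subtype]
  rw [this, nsmul_eq_mul, (CharP.cast_eq_zero_iff k p _).2 hd, zero_mul]

variable {k G : Type*} [Field k] [Group G] [TopologicalSpace G] [IsTopologicalGroup G]

/-- left translation -/
def L (g : G) : Module.End k (SmoothCc k G) where
  toFun f := ⟨fun x => f.1 (g⁻¹ * x), f.2.1.comp_continuous (continuous_const_mul g⁻¹),
    f.2.2.comp_homeomorph (Homeomorph.mulLeft g⁻¹)⟩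
  map_add' f h := rfl
  map_smul' c f := rfl

/-- right translation -/
def R (g : G) : Module.End k (SmoothCc k G) where
  toFun f := ⟨fun x => f.1 (x * g), f.2.1.comp_continuous (continuous_mul_const g),
    f.2.2.comp_homeomorph (Homeomorph.mulRight g)⟩
  map_add' f h := rfl
  map_smul' c f := rfl

lemma L_apply (g : G) (f : SmoothCc k G) (x : G) : (L g f).1 x = f.1 (g⁻¹ * x) := rfl
lemma R_apply (g : G) (f : SmoothCc k G) (x : G) : (R g f).1 x = f.1 (x * g) := rfl

/-- nice subgroups -/
structure Nice (U K : Subgroup G) : Prop where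
  le : K ≤ U
  isOpen : IsOpen (K : Set G)
  conj : ∀ u ∈ U, ∀ n ∈ K, u * n * u⁻¹ ∈ K

lemma Nice.conj' {U K : Subgroup G} (h : Nice U K) {u n : G} (hu : u ∈ U) (hn : n ∈ K) :
    u⁻¹ * n * u ∈ K := by
  simpa using h.conj u⁻¹ (U.inv_mem hu) n hn

lemma Nice.inf {U K K' : Subgroup G} (h : Nice U K) (h' : Nice U K') : Nice U (K ⊓ K') where
  le := inf_le_left.trans h.le
  isOpen := h.isOpen.inter h'.isOpen
  conj u hu n hn := ⟨h.conj u hu n hn.1, h'.conj u hu n hn.2⟩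

lemma Nice.isClosed {U K : Subgroup G} (h : Nice U K) : IsClosed (K : Set G) :=
  K.isClosed_of_isOpen h.isOpen

lemma Nice.isCompact {U K : Subgroup G} (h : Nice U K) (hU : IsCompact (U : Set G)) :
    IsCompact (K : Set G) := hU.of_isClosed_subset h.isClosed h.le

lemma exists_nice [T2Space G] [TotallyDisconnectedSpace G] {U : Subgroup G}
    (hU : IsCompact (U : Set G)) (hUo : IsOpen (U : Set G))
    {W : Set G} (hW : IsOpen W) (h1 : 1 ∈ W) : ∃ K, Nice U K ∧ (K : Set G) ⊆ W := by
  haveI : CompactSpace U := isCompact_iff_compactSpace.1 hU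
  obtain ⟨N, hN⟩ := ProfiniteGrp.exist_openNormalSubgroup_sub_open_nhds_of_one
    (G := U) (U := ((↑) : U → G) ⁻¹' W) (hW.preimage continuous_subtype_val) h1
  refine ⟨N.toSubgroup.map U.subtype, ⟨?_, ?_, ?_⟩, ?_⟩
  · rintro _ ⟨x, _, rfl⟩
    exact x.2
  · exact hUo.isOpenMap_subtype_val _ N.isOpen'
  · rintro u hu _ ⟨x, hx, rfl⟩
    exact ⟨_, N.isNormal'.conj_mem x hx ⟨u, hu⟩, rfl⟩
  · rintro _ ⟨x, hx, rfl⟩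
    exact hN hx

open scoped Classical in
/-- indicator -/
noncomputable def ind (k : Type*) [Field k] {U : Subgroup G} (hU : IsCompact (U : Set G))
    {K : Subgroup G} (h : Nice U K) :
    SmoothCc k G :=
  ⟨fun x => if x ∈ K then 1 else 0, by
    rw [IsLocallyConstant.iff_eventually_eq]
    intro x
    by_cases hx : x ∈ K
    · filter_upwards [h.isOpen.mem_nhds hx] with y hy
      have : y ∈ K := hy
      simp [hx, this]
    · filter_upwards [h.isClosed.isOpen_compl.mem_nhds hx] with y hy
      have : y ∉ K := hy
      simp [hx, this], by
    apply HasCompactSupport.intro (h.isCompact hU)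
    intro x hx
    have : x ∉ K := hx
    simp [this]⟩

open scoped Classical in
lemma ind_apply {U : Subgroup G} (hU : IsCompact (U : Set G))
    {K : Subgroup G} (h : Nice U K) (x : G) : (ind k hU h).1 x = if x ∈ K then 1 else 0 := rfl

section
variable {S : Module.End k (SmoothCc k G)} (hl : CommutesLeft S) (hr : CommutesRight S)
  {U : Subgroup G} (hU : IsCompact (U : Set G)) {K K' : Subgroup G} (h : Nice U K) (h' : Nice U K')

include hl in
lemma S_left (g : G) (f : SmoothCc k G) (x : G) : (S (L g f)).1 x = (S f).1 (g⁻¹ * x) :=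
  hl g f _ (fun _ => rfl) x

include hr in
lemma S_right (g : G) (f : SmoothCc k G) (x : G) : (S (R g f)).1 x = (S f).1 (x * g) :=
  hr g f _ (fun _ => rfl) x

include hl in
lemma F_left {g : G} (hg : g ∈ K) (x : G) :
    (S (ind k hU h)).1 (g * x) = (S (ind k hU h)).1 x := by
  have e : L g⁻¹ (ind k hU h) = ind k hU h := by
    apply Subtype.ext; funext x
    rw [L_apply, ind_apply, ind_apply, inv_inv]
    classical exact if_congr (K.mul_mem_cancel_left hg) rfl rfl
  have := S_left hl g⁻¹ (ind k hU h) x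
  rw [e, inv_inv] at this
  exact this.symm

include hr in
lemma F_right {g : G} (hg : g ∈ K) (x : G) :
    (S (ind k hU h)).1 (x * g) = (S (ind k hU h)).1 x := by
  have e : R g (ind k hU h) = ind k hU h := by
    apply Subtype.ext; funext x
    rw [R_apply, ind_apply, ind_apply]
    classical exact if_congr (K.mul_mem_cancel_right hg) rfl rfl
  have := S_right hr g (ind k hU h) x
  rw [e] at this
  exact this.symm

include hl hr in
lemma F_conj {u : G} (hu : u ∈ U) (x : G) :
    (S (ind k hU h)).1 (u * x * u⁻¹) = (S (ind k hU h)).1 x := by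
  have e : R u⁻¹ (L u⁻¹ (ind k hU h)) = ind k hU h := by
    apply Subtype.ext; funext x
    rw [R_apply, L_apply, ind_apply, ind_apply, inv_inv, ← mul_assoc]
    have : u * x * u⁻¹ ∈ K ↔ x ∈ K := by
      refine ⟨fun hx => ?_, h.conj u hu x⟩
      simpa [mul_assoc] using h.conj' hu hx
    classical exact if_congr this rfl rfl
  have h1 := S_right hr u⁻¹ (L u⁻¹ (ind k hU h)) x
  rw [e, S_left hl, inv_inv, ← mul_assoc] at h1
  exact h1.symm

include h h' in
lemma normal_sub : (K'.subgroupOf K).Normal :=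
  ⟨fun n hn g => h'.conj g (h.le g.2) n hn⟩

include hU h h' in
lemma finite_quot : Finite (K ⧸ K'.subgroupOf K) := by
  haveI : CompactSpace K := isCompact_iff_compactSpace.1 (h.isCompact hU)
  exact Subgroup.quotient_finite_of_isOpen _ (h'.isOpen.preimage continuous_subtype_val)

include hl in
lemma F_sum (hK : K' ≤ K) [Fintype (K ⧸ K'.subgroupOf K)] (x : G) :
    (S (ind k hU h)).1 x = ∑ q : K ⧸ K'.subgroupOf K, (S (ind k hU h')).1 ((q.out : G) * x) := by
  classical
  have e : ind k hU h = ∑ q : K ⧸ K'.subgroupOf K, L ((q.out : G)⁻¹) (ind k hU h') := by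
    apply Subtype.ext; funext x
    rw [AddSubmonoidClass.coe_finsetSum, Finset.sum_apply]
    simp only [L_apply, ind_apply, inv_inv]
    by_cases hx : x ∈ K
    · rw [if_pos hx, Finset.sum_eq_single (QuotientGroup.mk (⟨x, hx⟩⁻¹ : K))]
      · rw [if_pos]
        have := QuotientGroup.out_eq' (QuotientGroup.mk (s := K'.subgroupOf K) (⟨x, hx⟩⁻¹ : K))
        rw [QuotientGroup.eq] at this
        have h2 := h'.conj _ (h.le (QuotientGroup.mk (s := K'.subgroupOf K) (⟨x, hx⟩⁻¹ : K)).out.2) _ this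
        have h3 := K'.inv_mem h2
        simpa [mul_assoc] using h3
      · intro q _ hq
        rw [if_neg]
        intro hm
        apply hq
        rw [← QuotientGroup.out_eq' q]
        symm
        rw [QuotientGroup.eq, Subgroup.mem_subgroupOf]
        have := h'.conj _ (h.le hx) _ hm
        simpa [mul_assoc] using this
      · simp
    · rw [if_neg hx, Finset.sum_eq_zero]
      intro q _
      rw [if_neg]
      intro hm
      exact hx ((K.mul_mem_cancel_left q.out.2).1 (hK hm))
  rw [e, map_sum, AddSubmonoidClass.coe_finsetSum, Finset.sum_apply]
  simp only [S_left hl, inv_inv]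

end
end BC

namespace BC
variable {k G : Type*} [Field k] [Group G] [TopologicalSpace G] [IsTopologicalGroup G]
  {S : Module.End k (SmoothCc k G)} (hl : CommutesLeft S) (hr : CommutesRight S)
  {U : Subgroup G} (hU : IsCompact (U : Set G)) {K K' : Subgroup G} (h : Nice U K) (h' : Nice U K')

lemma isPGroup_quot {p : ℕ}
    (hpro : ∀ (V : Subgroup U) [V.Normal], IsOpen (V : Set U) → IsPGroup p (U ⧸ V))
    (h : Nice U K) (h' : Nice U K') [(K'.subgroupOf K).Normal] :
    IsPGroup p (K ⧸ K'.subgroupOf K) := by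
  rw [isPGroup_iff_pow_pow_eq_one]
  intro q
  obtain ⟨g, rfl⟩ := QuotientGroup.mk_surjective q
  have : (K'.subgroupOf U).Normal := ⟨fun n hn g => h'.conj g g.2 n hn⟩
  obtain ⟨n, hn⟩ := isPGroup_iff_pow_pow_eq_one.1
    (hpro (K'.subgroupOf U) (h'.isOpen.preimage continuous_subtype_val))
    (QuotientGroup.mk ⟨g.1, h.le g.2⟩)
  refine ⟨n, ?_⟩
  rw [← QuotientGroup.mk_pow, QuotientGroup.eq_one_iff] at hn ⊢
  simpa [Subgroup.mem_subgroupOf] using hn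

include hl h in
lemma F_out (x : G) (g : K) : (S (ind k hU h')).1
    ((((QuotientGroup.mk g : K ⧸ K'.subgroupOf K).out : K) : G) * x) =
      (S (ind k hU h')).1 ((g : G) * x) := by
  obtain ⟨n, hn⟩ := QuotientGroup.mk_out_eq_mul (K'.subgroupOf K) g
  rw [hn]
  have h2 : (g : G) * n.1.1 * (g : G)⁻¹ ∈ K' := h'.conj g (h.le g.2) _ n.2
  rw [← F_left hl hU h' h2 ((g : G) * x)]
  congr 1
  simp [mul_assoc]

include hl hr h h' in
lemma step1 {p : ℕ} (hp : p.Prime) [CharP k p]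
    (hpro : ∀ (V : Subgroup U) [V.Normal], IsOpen (V : Set U) → IsPGroup p (U ⧸ V))
    (hK : K' ≤ K) (x : G) (hx : (S (ind k hU h)).1 x ≠ 0) :
    ∃ g ∈ K, ∀ u ∈ K, x * u * x⁻¹ ∈ K → u * (g * x) * u⁻¹ * (g * x)⁻¹ ∈ K' := by
  have hfin := finite_quot hU h h'
  have hnor := normal_sub h h'
  have := Fintype.ofFinite (K ⧸ K'.subgroupOf K)
  have hP := isPGroup_quot hpro h h'
  rw [F_sum hl hU h h' hK] at hx
  let H : Subgroup G := K ⊓ K.comap (MulAut.conj x).toMonoidHom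
  let a0 : H →* K := Subgroup.inclusion inf_le_left
  let b0 : H →* K := ((MulAut.conj x).toMonoidHom.comp H.subtype).codRestrict K (fun u => u.2.2)
  obtain ⟨q, hq⟩ := exists_fixed hp hP ((QuotientGroup.mk' (K'.subgroupOf K)).comp a0)
    ((QuotientGroup.mk' (K'.subgroupOf K)).comp b0) _ (by
      intro u q
      obtain ⟨g, rfl⟩ := QuotientGroup.mk_surjective q
      change (S (ind k hU h')).1
        ((((QuotientGroup.mk (a0 u * g * (b0 u)⁻¹) : K ⧸ K'.subgroupOf K).out : K) : G) * x) = _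
      rw [F_out hl hU h h', F_out hl hU h h', ← F_conj hl hr hU h' (h.le u.2.1) (g * x)]
      refine congrArg (S (ind k hU h')).1 ?_
      change (u : G) * g * (x * u * x⁻¹)⁻¹ * x = _
      group) hx
  obtain ⟨g, rfl⟩ := QuotientGroup.mk_surjective q
  refine ⟨g, g.2, fun u hu hu' => ?_⟩
  have h1 : (QuotientGroup.mk (a0 ⟨u, hu, hu'⟩ * g * (b0 ⟨u, hu, hu'⟩)⁻¹) : K ⧸ K'.subgroupOf K)
    = QuotientGroup.mk g := hq ⟨u, hu, hu'⟩
  rw [QuotientGroup.eq, Subgroup.mem_subgroupOf] at h1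
  have h2 : (u * g * (x * u * x⁻¹)⁻¹)⁻¹ * (g : G) ∈ K' := h1
  have h3 := K'.inv_mem (h'.conj g (h.le g.2) _ h2)
  convert h3 using 1
  group

include hl hr h in
lemma supp [T2Space G] [TotallyDisconnectedSpace G] (hUo : IsOpen (U : Set G))
    {p : ℕ} (hp : p.Prime) [CharP k p]
    (hpro : ∀ (V : Subgroup U) [V.Normal], IsOpen (V : Set U) → IsPGroup p (U ⧸ V))
    (hG : ∀ y : G, IsOpen ((Subgroup.centralizer {y} : Subgroup G) : Set G) →
      y ∈ Subgroup.center G)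
    (x : G) (hx : (S (ind k hU h)).1 x ≠ 0) :
    ∃ g ∈ K, g * x ∈ Subgroup.center G := by
  let ι := {K' : Subgroup G // Nice U K' ∧ K' ≤ K}
  have : Nonempty ι := ⟨⟨K, h, le_rfl⟩⟩
  let t : ι → Set G := fun i => {g | g ∈ K ∧ ∀ u ∈ K, x * u * x⁻¹ ∈ K →
    u * (g * x) * u⁻¹ * (g * x)⁻¹ ∈ i.1}
  have hcl : ∀ i, IsClosed (t i) := by
    intro i
    have : t i = (K : Set G) ∩ ⋂ u ∈ K, ⋂ (_ : x * u * x⁻¹ ∈ K),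
      (fun g => u * (g * x) * u⁻¹ * (g * x)⁻¹) ⁻¹' (i.1 : Set G) := by
      ext g; simp [t]
    rw [this]
    refine h.isClosed.inter (isClosed_biInter fun u _ => isClosed_iInter fun _ => ?_)
    exact i.2.1.isClosed.preimage (by fun_prop)
  obtain ⟨g, hg⟩ := IsCompact.nonempty_iInter_of_directed_nonempty_isCompact_isClosed t
    (by
      intro i j
      refine ⟨⟨i.1 ⊓ j.1, i.2.1.inf j.2.1, inf_le_left.trans i.2.2⟩, ?_, ?_⟩
      · exact fun g hg => ⟨hg.1, fun u hu hu' => (hg.2 u hu hu').1⟩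
      · exact fun g hg => ⟨hg.1, fun u hu hu' => (hg.2 u hu hu').2⟩)
    (by
      intro i
      obtain ⟨g, hg, hg'⟩ := step1 hl hr hU h i.2.1 hp hpro i.2.2 x hx
      exact ⟨g, hg, hg'⟩)
    (fun i => (h.isCompact hU).of_isClosed_subset (hcl i) fun g hg => hg.1)
    hcl
  rw [Set.mem_iInter] at hg
  refine ⟨g, (hg ⟨K, h, le_rfl⟩).1, hG _ ?_⟩
  let H : Subgroup G := K ⊓ K.comap (MulAut.conj x).toMonoidHom
  have hHo : IsOpen (H : Set G) := by
    refine h.isOpen.inter (h.isOpen.preimage (f := fun u => x * u * x⁻¹) (by fun_prop))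
  refine Subgroup.isOpen_mono (H₁ := H) ?_ hHo
  intro u hu
  rw [Subgroup.mem_centralizer_singleton_iff]
  by_contra hne
  have hne1 : u * (g * x) * u⁻¹ * (g * x)⁻¹ ≠ 1 := by
    intro h1
    apply hne
    rw [mul_inv_eq_one, mul_inv_eq_iff_eq_mul] at h1
    exact h1
  obtain ⟨K', hK', hsub⟩ := exists_nice hU hUo
    (W := {u * (g * x) * u⁻¹ * (g * x)⁻¹}ᶜ) isOpen_compl_singleton (by simpa using hne1.symm)
  have := (hg ⟨K' ⊓ K, hK'.inf h, inf_le_right⟩).2 u hu.1 hu.2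
  exact hsub this.1 rfl

/-- Vanishing. -/
lemma vanish [T2Space G] [TotallyDisconnectedSpace G] (hl : CommutesLeft S) (hr : CommutesRight S)
    (hU : IsCompact (U : Set G)) (hUo : IsOpen (U : Set G))
    {p : ℕ} (hp : p.Prime) [CharP k p]
    (hpro : ∀ (V : Subgroup U) [V.Normal], IsOpen (V : Set U) → IsPGroup p (U ⧸ V))
    (hG : ∀ y : G, IsOpen ((Subgroup.centralizer {y} : Subgroup G) : Set G) →
      y ∈ Subgroup.center G) (h : Nice U K)
    (hKZ : ∀ z ∈ Subgroup.center G, z ∈ K → z = 1)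
    (h0 : ∀ z ∈ Subgroup.center G, (S (ind k hU h)).1 z = 0) : S = 0 := by
  -- vanishing on small subgroups
  have key : ∀ (K' : Subgroup G) (h' : Nice U K'), K' ≤ K → S (ind k hU h') = 0 := by
    intro K' h' hK
    have hz : ∀ z ∈ Subgroup.center G, (S (ind k hU h')).1 z = 0 := by
      intro z hz
      have hfin := finite_quot hU h h'
      have := Fintype.ofFinite (K ⧸ K'.subgroupOf K)
      have h1 := h0 z hz
      rw [F_sum hl hU h h' hK, Finset.sum_eq_single (QuotientGroup.mk (1 : K)),
        F_out hl hU h h'] at h1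
      · simpa using h1
      · intro q _ hq
        by_contra hne
        apply hq
        obtain ⟨g, hg, hgz⟩ := supp hl hr hU h' hUo hp hpro hG _ hne
        have hc : g * q.out ∈ Subgroup.center G := by
          have := Subgroup.mul_mem _ hgz (Subgroup.inv_mem _ hz)
          simpa [mul_assoc] using this
        have h2 := hKZ _ hc (K.mul_mem (hK hg) q.out.2)
        rw [← QuotientGroup.out_eq' q]
        symm
        rw [QuotientGroup.eq, Subgroup.mem_subgroupOf]
        simp only [inv_one, one_mul]
        rw [eq_inv_of_mul_eq_one_right h2]
        exact K'.inv_mem hg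
      · simp
    apply Subtype.ext; funext x
    by_contra hne
    obtain ⟨g, hg, hgz⟩ := supp hl hr hU h' hUo hp hpro hG x hne
    have := hz _ hgz
    rw [F_left hl hU h' hg] at this
    exact hne this
  apply LinearMap.ext
  intro f
  -- uniform local constancy
  obtain ⟨V, hVo, hV1, hV⟩ : ∃ V : Set G, IsOpen V ∧ 1 ∈ V ∧
      ∀ x ∈ tsupport f.1, ∀ v ∈ V, f.1 (x * v) = f.1 x := by
    have hopen : IsOpen {q : G × G | f.1 (q.1 * q.2) = f.1 q.1} := by
      have c1 : IsLocallyConstant fun q : G × G => f.1 (q.1 * q.2) :=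
        f.2.1.comp_continuous continuous_mul
      have c2 : IsLocallyConstant fun q : G × G => f.1 q.1 :=
        f.2.1.comp_continuous continuous_fst
      have := (c1.sub c2).isOpen_fiber 0
      simpa [sub_eq_zero] using this
    obtain ⟨A, V, _, hVo, hA, hV, hAV⟩ := generalized_tube_lemma f.2.2 (isCompact_singleton (x := (1 : G)))
      hopen (by
        rintro ⟨x, y⟩ ⟨_, hy⟩
        have : y = 1 := hy
        simp [this])
    exact ⟨V, hVo, hV rfl, fun x hx v hv => hAV (Set.mk_mem_prod (hA hx) hv)⟩
  obtain ⟨K₁, h₁, hsub⟩ := exists_nice hU hUo hVo hV1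
  have hN := h₁.inf h
  have hinv : ∀ x, ∀ v ∈ K₁ ⊓ K, f.1 (x * v) = f.1 x := by
    intro x v hv
    by_cases hx : x ∈ tsupport f.1
    · exact hV x hx v (hsub hv.1)
    · by_cases hxv : x * v ∈ tsupport f.1
      · have := hV _ hxv v⁻¹ (hsub (K₁.inv_mem hv.1))
        simpa using this.symm
      · rw [image_eq_zero_of_notMem_tsupport hx, image_eq_zero_of_notMem_tsupport hxv]
  have hdisc : DiscreteTopology (G ⧸ (K₁ ⊓ K)) := QuotientGroup.discreteTopology hN.isOpen
  have hfin : ((QuotientGroup.mk : G → G ⧸ (K₁ ⊓ K)) '' tsupport f.1).Finite :=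
    (IsCompact.image f.2.2 QuotientGroup.continuous_mk).finite_of_discrete
  have e : f = ∑ q ∈ hfin.toFinset, f.1 q.out • L q.out (ind k hU hN) := by
    classical
    apply Subtype.ext; funext x
    rw [AddSubmonoidClass.coe_finsetSum, Finset.sum_apply]
    have hterm : ∀ q : G ⧸ (K₁ ⊓ K), (f.1 q.out • L q.out (ind k hU hN)).1 x =
        if q = QuotientGroup.mk x then f.1 x else 0 := by
      intro q
      change f.1 q.out * (ind k hU hN).1 (q.out⁻¹ * x) = _
      rw [ind_apply]
      have hiff : q.out⁻¹ * x ∈ K₁ ⊓ K ↔ q = QuotientGroup.mk x := by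
        rw [← QuotientGroup.eq, QuotientGroup.out_eq']
      by_cases hq : q = QuotientGroup.mk x
      · rw [if_pos (hiff.2 hq), if_pos hq, mul_one, ← hinv _ _ (hiff.2 hq)]
        simp
      · rw [if_neg (fun hh => hq (hiff.1 hh)), if_neg hq, mul_zero]
    simp only [hterm]
    rw [Finset.sum_ite_eq']
    split_ifs with hx
    · rfl
    · apply image_eq_zero_of_notMem_tsupport
      intro hx'
      exact hx (hfin.mem_toFinset.2 ⟨x, hx', rfl⟩)
  rw [e, map_sum]
  apply Finset.sum_eq_zero
  intro q _
  rw [map_smul]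
  have : S (L q.out (ind k hU hN)) = 0 := by
    apply Subtype.ext; funext x
    rw [S_left hl, key _ hN inf_le_right]
    rfl
  rw [this, smul_zero]

/-- The translation action of the center. -/
def LZ (k G : Type*) [Field k] [Group G] [TopologicalSpace G] [IsTopologicalGroup G] :
    Subgroup.center G →* Module.End k (SmoothCc k G) where
  toFun z := L z.1
  map_one' := by
    apply LinearMap.ext; intro f; apply Subtype.ext; funext x
    simp [L_apply]
  map_mul' a b := by
    apply LinearMap.ext; intro f; apply Subtype.ext; funext x
    change f.1 ((a.1 * b.1)⁻¹ * x) = f.1 (b.1⁻¹ * (a.1⁻¹ * x))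
    simp [mul_assoc]

lemma lift_LZ_apply (a : MonoidAlgebra k (Subgroup.center G)) (f : SmoothCc k G) (x : G) :
    (MonoidAlgebra.lift k _ _ (LZ k G) a f).1 x
      = a.coeff.sum fun z c => c * f.1 ((z : G)⁻¹ * x) := by
  rw [MonoidAlgebra.lift_apply, Finsupp.sum, Finsupp.sum, LinearMap.sum_apply,
    AddSubmonoidClass.coe_finsetSum, Finset.sum_apply]
  rfl

lemma lift_LZ_ind (a : MonoidAlgebra k (Subgroup.center G)) (hU : IsCompact (U : Set G))
    (h : Nice U K) (hKZ : ∀ z ∈ Subgroup.center G, z ∈ K → z = 1) (z : Subgroup.center G) :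
    (MonoidAlgebra.lift k _ _ (LZ k G) a (ind k hU h)).1 z = a.coeff z := by
  classical
  rw [lift_LZ_apply, Finsupp.sum, Finset.sum_eq_single z]
  · rw [ind_apply, if_pos (by simp [K.one_mem]), mul_one]
  · intro w _ hw
    rw [ind_apply, if_neg, mul_zero]
    intro hm
    have := hKZ _ (w⁻¹ * z).2 hm
    apply hw
    apply Subtype.ext
    exact inv_mul_eq_one.1 this
  · intro hz
    rw [Finsupp.notMem_support_iff.1 hz, zero_mul]

lemma lift_commL (a : MonoidAlgebra k (Subgroup.center G)) :
    CommutesLeft (MonoidAlgebra.lift k _ _ (LZ k G) a) := by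
  intro g f f' hf x
  change (MonoidAlgebra.lift k _ _ (LZ k G) a f').1 x = (MonoidAlgebra.lift k _ _ (LZ k G) a f).1 _
  rw [lift_LZ_apply, lift_LZ_apply]
  apply Finsupp.sum_congr
  intro z _
  rw [hf, ← mul_assoc, ← mul_assoc, ← Subgroup.mem_center_iff.1 (Subgroup.inv_mem _ z.2) g⁻¹]

lemma lift_commR (a : MonoidAlgebra k (Subgroup.center G)) :
    CommutesRight (MonoidAlgebra.lift k _ _ (LZ k G) a) := by
  intro g f f' hf x
  change (MonoidAlgebra.lift k _ _ (LZ k G) a f').1 x = (MonoidAlgebra.lift k _ _ (LZ k G) a f).1 _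
  rw [lift_LZ_apply, lift_LZ_apply]
  apply Finsupp.sum_congr
  intro z _
  rw [hf, ← mul_assoc]

end BC

/-- Let `p` be a prime, `k` a field of characteristic `p`, and `G` a
locally profinite group containing an open pro-`p` subgroup, containing no proper open
centralisers, and whose center `Z(G)` is finite.  Then the `k`-algebra of endomorphisms of
`C_c^∞(G,k)` commuting with both the left and the right translation actions of `G` (the
Bernstein center) is isomorphic as a `k`-algebra to the group algebra `k[Z(G)]`: there is
an injective `k`-algebra homomorphism `k[Z(G)] → End_k(C_c^∞(G,k))` with image exactly
this algebra. -/
theorem stmt_18 (p : ℕ) (hp : p.Prime) (k G : Type*) [Field k] [CharP k p]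
    [Group G] [TopologicalSpace G] [IsTopologicalGroup G]
    [LocallyCompactSpace G] [T2Space G] [TotallyDisconnectedSpace G]
    (hpro : ∃ U : Subgroup G, IsCompact (U : Set G) ∧ IsOpen (U : Set G) ∧
      ∀ (V : Subgroup U) [V.Normal], IsOpen (V : Set U) → IsPGroup p (U ⧸ V))
    (hG : ∀ y : G, IsOpen ((Subgroup.centralizer {y} : Subgroup G) : Set G) →
      y ∈ Subgroup.center G)
    (hZfin : Finite (Subgroup.center G)) :
    ∃ Φ : MonoidAlgebra k (Subgroup.center G) →ₐ[k] Module.End k (SmoothCc k G),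
      Function.Injective Φ ∧
        Set.range Φ = {T | CommutesLeft T ∧ CommutesRight T} := by
  obtain ⟨U, hU, hUo, hpro⟩ := hpro
  obtain ⟨K, h, hsub⟩ := BC.exists_nice hU hUo
    (W := ((Subgroup.center G : Set G) \ {1})ᶜ)
    (((Set.toFinite (Subgroup.center G : Set G)).sdiff).isClosed.isOpen_compl) (by simp)
  have hKZ : ∀ z ∈ Subgroup.center G, z ∈ K → z = 1 := by
    intro z hz hzK
    by_contra hne
    exact hsub hzK ⟨hz, hne⟩
  refine ⟨MonoidAlgebra.lift k _ _ (BC.LZ k G), ?_, ?_⟩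
  · intro a b hab
    apply MonoidAlgebra.coeff_injective
    ext z
    rw [← BC.lift_LZ_ind a hU h hKZ, hab, BC.lift_LZ_ind b hU h hKZ]
  · ext T
    constructor
    · rintro ⟨a, rfl⟩
      exact ⟨BC.lift_commL a, BC.lift_commR a⟩
    · rintro ⟨hTl, hTr⟩
      let a : MonoidAlgebra k (Subgroup.center G) :=
        MonoidAlgebra.ofCoeff (Finsupp.equivFunOnFinite.symm fun z => (T (BC.ind k hU h)).1 z)
      refine ⟨a, ?_⟩
      symm
      rw [← sub_eq_zero]
      refine BC.vanish (S := T - MonoidAlgebra.lift k _ _ (BC.LZ k G) a)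
        ?_ ?_ hU hUo hp hpro hG h hKZ ?_
      · intro g f f' hf x
        exact congrArg₂ (· - ·) (hTl g f f' hf x) (BC.lift_commL a g f f' hf x)
      · intro g f f' hf x
        exact congrArg₂ (· - ·) (hTr g f f' hf x) (BC.lift_commR a g f f' hf x)
      · intro z hz
        have := BC.lift_LZ_ind a hU h hKZ ⟨z, hz⟩
        change (T (BC.ind k hU h)).1 z
          - (MonoidAlgebra.lift k _ _ (BC.LZ k G) a (BC.ind k hU h)).1 z = 0
        rw [this]
        exact sub_self _
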